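/- Fix an integer n ≥ 2, c ∈ (0,1), and φ ∈ ℝ. Then lim_{θ→π/2−} (∂²ρ_c/∂θ²)(θ,φ) = −1 and lim_{θ→−π/2+} (∂²ρ_c/∂θ²)(θ,φ) = 1. -/

import Mathlib

open Real Set Filter Topology

/-- `Fc c x` is the function `F_c(x)` from the paper. -/
noncomputable def Fc (c x : ℝ) : ℝ :=
  (c * x ^ 2 + (1 - c) * (1 - x) ^ 2 * (c * x / (c + x))) / (c * x + (1 - c) * (1 - x) ^ 2)

/-- `fc c θ = π·F_c(θ/π + 1/2) − π/2`. -/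
noncomputable def fc (c θ : ℝ) : ℝ := π * Fc c (θ / π + 1 / 2) - π / 2

/-- `gc c θ = −f_c(−θ)`. -/
noncomputable def gc (c θ : ℝ) : ℝ := -fc c (-θ)

/-- `ac n c θ φ` is the function `a_c(θ,φ)` from the paper. -/
noncomputable def ac (n : ℕ) (c θ φ : ℝ) : ℝ :=
  Real.cos (n * φ / 2) ^ 2 * Real.cos (fc c θ) ^ 2 /
    (Real.cos (n * φ / 2) ^ 2 * Real.cos (fc c θ) ^ 2 +
      Real.sin (n * φ / 2) ^ 2 * Real.cos (gc c θ) ^ 2)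

/-- `ρc n c θ φ` is the function `ρ_c(θ,φ)` from the paper. -/
noncomputable def ρc (n : ℕ) (c θ φ : ℝ) : ℝ :=
  ac n c θ φ * Real.sin (fc c θ) + (1 - ac n c θ φ) * Real.sin (gc c θ)

lemma analyticAt_dslope_aux {f : ℝ → ℝ} (hf : AnalyticAt ℝ f 0) :
    AnalyticAt ℝ (dslope f 0) 0 := by
  obtain ⟨p, hp⟩ := hf
  exact ⟨_, hp.has_fpower_series_dslope_fslope⟩

lemma sin_expand : ∃ T : ℝ → ℝ, AnalyticAt ℝ T 0 ∧ ∀ w, Real.sin w = w + w ^ 2 * T w := by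
  have h1 : AnalyticAt ℝ (dslope Real.sin 0) 0 :=
    analyticAt_dslope_aux Real.analyticAt_sin
  refine ⟨dslope (dslope Real.sin 0) 0, analyticAt_dslope_aux h1, fun w => ?_⟩
  have e1 := sub_smul_dslope Real.sin 0 w
  have e2 := sub_smul_dslope (dslope Real.sin 0) 0 w
  have e3 : dslope Real.sin 0 0 = 1 := by simp [dslope_same]
  rw [e3] at e2
  simp only [sub_zero, smul_eq_mul, Real.sin_zero] at e1 e2
  linear_combination -e1 - w * e2

/-- Second derivative of a function with a known second order expansion. -/
lemma deriv2_lim {R k : ℝ → ℝ} {x0 σ : ℝ} (hk : AnalyticAt ℝ k x0)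
    (hR : ∀ᶠ θ in 𝓝[≠] x0, R θ = σ * (1 - (θ - x0) ^ 2 / 2 + (θ - x0) ^ 3 * k θ)) :
    Tendsto (fun θ : ℝ => deriv (fun t => deriv (fun s => R s) t) θ) (𝓝[≠] x0) (𝓝 (-σ)) := by
  set Q : ℝ → ℝ := fun θ => σ * (1 - (θ - x0) ^ 2 / 2 + (θ - x0) ^ 3 * k θ) with hQ
  have hQa : AnalyticAt ℝ Q x0 := by fun_prop
  have hE : R =ᶠ[𝓝[≠] x0] Q := hR
  have hE2 : deriv (deriv R) =ᶠ[𝓝[≠] x0] deriv (deriv Q) := hE.nhdsNE_deriv.nhdsNE_deriv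
  have hc : ContinuousAt (deriv (deriv Q)) x0 := hQa.deriv.deriv.continuousAt
  have hd : deriv Q =ᶠ[𝓝 x0] fun θ =>
      σ * (-(θ - x0) + (θ - x0) ^ 2 * (3 * k θ + (θ - x0) * deriv k θ)) := by
    filter_upwards [hk.eventually_analyticAt] with θ hθ
    have h0 : HasDerivAt (fun θ : ℝ => θ - x0) 1 θ := (hasDerivAt_id θ).sub_const x0
    have h1 := ((((h0.pow 2).div_const 2).const_sub 1).add
      ((h0.pow 3).mul hθ.differentiableAt.hasDerivAt)).const_mul σ
    have h2 : HasDerivAt Q _ θ := h1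
    rw [h2.deriv]
    simp only [Pi.pow_apply]
    push_cast
    ring
  have hv : deriv (deriv Q) x0 = -σ := by
    rw [hd.deriv_eq]
    have hm : DifferentiableAt ℝ (fun θ => 3 * k θ + (θ - x0) * deriv k θ) x0 := by
      have := hk.deriv
      have : AnalyticAt ℝ (fun θ => 3 * k θ + (θ - x0) * deriv k θ) x0 := by fun_prop
      exact this.differentiableAt
    have h0 : HasDerivAt (fun θ : ℝ => θ - x0) 1 x0 := (hasDerivAt_id x0).sub_const x0
    have h1 := (h0.neg.add ((h0.pow 2).mul hm.hasDerivAt)).const_mul σ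
    have h2 : HasDerivAt (fun θ =>
      σ * (-(θ - x0) + (θ - x0) ^ 2 * (3 * k θ + (θ - x0) * deriv k θ))) _ x0 := h1
    rw [h2.deriv]
    simp
  rw [← hv]
  exact (hc.tendsto.mono_left nhdsWithin_le_nhds).congr' hE2.symm

/-- `f θ = θ + O((θ - x0)^2)` with analytic remainder. -/
def Tang (f : ℝ → ℝ) (x0 : ℝ) : Prop :=
  ∃ A : ℝ → ℝ, AnalyticAt ℝ A x0 ∧ ∀ᶠ θ in 𝓝 x0, f θ = θ + (θ - x0) ^ 2 * A θ

lemma Tang.trig {f : ℝ → ℝ} {x0 σ : ℝ} (h : Tang f x0) (hσ : σ ^ 2 = 1) (hx : x0 = σ * (π / 2)) :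
    ∃ U K : ℝ → ℝ, AnalyticAt ℝ U x0 ∧ AnalyticAt ℝ K x0 ∧ U x0 = 1 ∧
      ∀ᶠ θ in 𝓝 x0, Real.cos (f θ) ^ 2 = (θ - x0) ^ 2 * U θ ∧
        Real.sin (f θ) = σ * (1 - (θ - x0) ^ 2 / 2 + (θ - x0) ^ 3 * K θ) := by
  obtain ⟨A, hA, hf⟩ := h
  obtain ⟨T, hT, hs⟩ := sin_expand
  have hc : ∀ w, Real.cos w = 1 - w ^ 2 / 2 * (1 + w / 2 * T (w / 2)) ^ 2 := by
    intro w
    have e1 := Real.cos_sq_add_sin_sq (w / 2)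
    have e2 := Real.cos_two_mul (w / 2)
    have e3 := hs (w / 2)
    rw [show 2 * (w / 2) = w by ring] at e2
    rw [e3] at e1
    linear_combination e2 + 2 * e1
  have hcs : Real.cos x0 = 0 ∧ Real.sin x0 = σ := by
    rcases (sq_eq_sq_iff_eq_or_eq_neg.1 (hσ.trans (one_pow 2).symm)) with h | h <;> subst h <;> simp [hx]
  set w : ℝ → ℝ := fun θ => (θ - x0) * (1 + (θ - x0) * A θ) with hw
  have hwa : AnalyticAt ℝ w x0 := by fun_prop
  have hw0 : w x0 = 0 := by simp [hw]
  obtain ⟨T1, hT1, eT1⟩ : ∃ T1 : ℝ → ℝ, AnalyticAt ℝ T1 x0 ∧ ∀ θ, T1 θ = T (w θ) :=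
    ⟨fun θ => T (w θ), AnalyticAt.fun_comp (by rw [hw0]; exact hT) hwa, fun _ => rfl⟩
  obtain ⟨T2, hT2, eT2⟩ : ∃ T2 : ℝ → ℝ, AnalyticAt ℝ T2 x0 ∧ ∀ θ, T2 θ = T (w θ / 2) :=
    ⟨fun θ => T (w θ / 2), AnalyticAt.fun_comp (g := T) (f := fun θ => w θ / 2)
      (by simpa [hw0] using hT) (by fun_prop), fun _ => rfl⟩
  -- B : 1 + w/2 T(w/2) = 1 + t B
  set B : ℝ → ℝ := fun θ => (1 + (θ - x0) * A θ) / 2 * T2 θ with hB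
  have hBa : AnalyticAt ℝ B x0 := by fun_prop
  -- cos w = 1 - t^2/2 ((1+tA)(1+tB))^2, (1+tA)(1+tB) = 1 + t C
  set C : ℝ → ℝ := fun θ => A θ + B θ + (θ - x0) * A θ * B θ with hC
  have hCa : AnalyticAt ℝ C x0 := by fun_prop
  refine ⟨fun θ => ((1 + (θ - x0) * A θ) * (1 + w θ * T1 θ)) ^ 2,
    fun θ => - (2 * C θ + (θ - x0) * C θ ^ 2) / 2, by fun_prop, by fun_prop, by simp [hw0], ?_⟩
  filter_upwards [hf] with θ hθ
  have hfe : f θ = x0 + w θ := by rw [hθ, hw]; ring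
  rw [hfe, Real.cos_add, Real.sin_add, hcs.1, hcs.2]
  constructor
  · rw [hs (w θ), ← eT1]
    beta_reduce
    have : w θ = (θ - x0) * (1 + (θ - x0) * A θ) := rfl
    generalize T1 θ = z
    rw [this]
    linear_combination ((θ - x0) * (1 + (θ - x0) * A θ) +
      ((θ - x0) * (1 + (θ - x0) * A θ)) ^ 2 * z) ^ 2 * hσ
  · rw [hc (w θ), ← eT2]
    simp only [hC, hB]
    generalize T2 θ = z
    simp only [hw]
    ring

lemma blend {f g : ℝ → ℝ} {x0 σ p q : ℝ} (hf : Tang f x0) (hg : Tang g x0) (hσ : σ ^ 2 = 1)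
    (hx : x0 = σ * (π / 2)) (hpq : p + q = 1) :
    ∃ k : ℝ → ℝ, AnalyticAt ℝ k x0 ∧ ∀ᶠ θ in 𝓝[≠] x0,
      p * Real.cos (f θ) ^ 2 / (p * Real.cos (f θ) ^ 2 + q * Real.cos (g θ) ^ 2) * Real.sin (f θ) +
      (1 - p * Real.cos (f θ) ^ 2 / (p * Real.cos (f θ) ^ 2 + q * Real.cos (g θ) ^ 2)) *
        Real.sin (g θ) = σ * (1 - (θ - x0) ^ 2 / 2 + (θ - x0) ^ 3 * k θ) := by
  obtain ⟨U, K, hU, hK, hU1, hE⟩ := hf.trig hσ hx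
  obtain ⟨V, L, hV, hL, hV1, hE'⟩ := hg.trig hσ hx
  have hD : p * U x0 + q * V x0 ≠ 0 := by simp [hU1, hV1, hpq]
  have ha : AnalyticAt ℝ (fun θ => p * U θ / (p * U θ + q * V θ)) x0 :=
    AnalyticAt.div (by fun_prop) (by fun_prop) hD
  refine ⟨fun θ => (p * U θ / (p * U θ + q * V θ)) * K θ +
    (1 - p * U θ / (p * U θ + q * V θ)) * L θ, by fun_prop, ?_⟩
  filter_upwards [nhdsWithin_le_nhds hE, nhdsWithin_le_nhds hE', self_mem_nhdsWithin] with θ h1 h2 h3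
  have ht : (θ - x0) ^ 2 ≠ 0 := pow_ne_zero _ (sub_ne_zero.2 h3)
  have e : p * Real.cos (f θ) ^ 2 / (p * Real.cos (f θ) ^ 2 + q * Real.cos (g θ) ^ 2) =
      p * U θ / (p * U θ + q * V θ) := by
    rw [h1.1, h2.1, ← mul_div_mul_left (p * U θ) (p * U θ + q * V θ) ht]
    congr 1 <;> ring
  rw [e, h1.2, h2.2]
  ring

lemma Fc_eq {c x : ℝ} (h1 : c + x ≠ 0) (h2 : c * x + (1 - c) * (1 - x) ^ 2 ≠ 0) :
    Fc c x = x - (1 - c) * (1 - x) ^ 2 * x ^ 2 /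
      ((c + x) * (c * x + (1 - c) * (1 - x) ^ 2)) := by
  unfold Fc
  rw [eq_sub_iff_add_eq, div_add_div _ _ h2 (mul_ne_zero h1 h2), div_eq_iff (by positivity)]
  field_simp
  ring

lemma tang_fc {c x0 : ℝ} (hc : c ∈ Set.Ioo (0 : ℝ) 1) (hx : x0 = π / 2 ∨ x0 = -(π / 2)) :
    Tang (fc c) x0 := by
  obtain ⟨hc0, hc1⟩ := hc
  have hpi := Real.pi_pos
  set X : ℝ → ℝ := fun θ => θ / π + 1 / 2 with hX
  have hXa : AnalyticAt ℝ X x0 := by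
    simp only [hX, div_eq_mul_inv]; fun_prop
  have hX0 : X x0 = 1 ∨ X x0 = 0 := by
    rcases hx with h | h
    · left; rw [hX, h]; field_simp; norm_num
    · right; rw [hX, h]; field_simp; norm_num
  have h1 : c + X x0 ≠ 0 := by rcases hX0 with h | h <;> rw [h] <;> linarith
  have h2 : c * X x0 + (1 - c) * (1 - X x0) ^ 2 ≠ 0 := by
    rcases hX0 with h | h <;> rw [h] <;> norm_num <;> linarith
  have h1' : ∀ᶠ θ in 𝓝 x0, c + X θ ≠ 0 :=
    (AnalyticAt.continuousAt (𝕜 := ℝ) (f := fun θ => c + X θ) (by fun_prop)).eventually_ne h1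
  have h2' : ∀ᶠ θ in 𝓝 x0, c * X θ + (1 - c) * (1 - X θ) ^ 2 ≠ 0 :=
    (AnalyticAt.continuousAt (𝕜 := ℝ) (f := fun θ => c * X θ + (1 - c) * (1 - X θ) ^ 2)
      (by fun_prop)).eventually_ne h2
  -- the remaining factor
  have hY : ∃ Y : ℝ → ℝ, AnalyticAt ℝ Y x0 ∧
      ∀ θ, (1 - X θ) ^ 2 * X θ ^ 2 = (θ - x0) ^ 2 * Y θ := by
    rcases hx with h | h
    · refine ⟨fun θ => (π⁻¹) ^ 2 * X θ ^ 2, by fun_prop, fun θ => ?_⟩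
      simp only [hX, h]; field_simp; ring
    · refine ⟨fun θ => (π⁻¹) ^ 2 * (1 - X θ) ^ 2, by fun_prop, fun θ => ?_⟩
      simp only [hX, h]; field_simp; ring
  obtain ⟨Y, hYa, hY⟩ := hY
  refine ⟨fun θ => -(π * (1 - c) * Y θ) / ((c + X θ) * (c * X θ + (1 - c) * (1 - X θ) ^ 2)),
    AnalyticAt.div (by fun_prop) (by fun_prop) (mul_ne_zero h1 h2), ?_⟩
  filter_upwards [h1', h2'] with θ g1 g2
  have e : fc c θ = π * Fc c (X θ) - π / 2 := rfl
  have e2 : π * X θ = θ + π / 2 := by simp only [hX]; field_simp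
  rw [e, Fc_eq g1 g2, mul_assoc (1 - c), hY θ]
  linear_combination e2

lemma tang_gc {c x0 : ℝ} (hc : c ∈ Set.Ioo (0 : ℝ) 1) (hx : x0 = π / 2 ∨ x0 = -(π / 2)) :
    Tang (gc c) x0 := by
  have hx' : -x0 = π / 2 ∨ -x0 = -(π / 2) := by
    rcases hx with h | h
    · right; rw [h]
    · left; rw [h, neg_neg]
  obtain ⟨A, hA, hE⟩ := tang_fc hc hx'
  have hAn : AnalyticAt ℝ (fun θ => A (-θ)) x0 :=
    AnalyticAt.fun_comp (g := A) (f := fun θ => -θ) hA (by fun_prop)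
  refine ⟨fun θ => -A (-θ), by fun_prop, ?_⟩
  have ht : Tendsto (fun θ : ℝ => -θ) (𝓝 x0) (𝓝 (-x0)) := continuous_neg.tendsto x0
  filter_upwards [ht.eventually hE] with θ h
  rw [gc, h]
  ring

lemma rho_lim (n : ℕ) {c x0 σ : ℝ} (hc : c ∈ Set.Ioo (0 : ℝ) 1) (φ : ℝ)
    (hx : x0 = π / 2 ∨ x0 = -(π / 2)) (hσ : σ ^ 2 = 1) (hxσ : x0 = σ * (π / 2)) :
    Tendsto (fun θ : ℝ => deriv (fun t => deriv (fun s => ρc n c s φ) t) θ)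
      (𝓝[≠] x0) (𝓝 (-σ)) := by
  obtain ⟨k, hk, hE⟩ := blend (tang_fc hc hx) (tang_gc hc hx) hσ hxσ
    (Real.cos_sq_add_sin_sq (n * φ / 2))
  exact deriv2_lim hk hE

theorem stmt_13 (n : ℕ) (hn : 2 ≤ n) (c : ℝ) (hc : c ∈ Set.Ioo (0 : ℝ) 1) (φ : ℝ) :
    Tendsto (fun θ : ℝ => deriv (fun t => deriv (fun s => ρc n c s φ) t) θ)
        (𝓝[<] (π / 2)) (𝓝 (-1)) ∧
      Tendsto (fun θ : ℝ => deriv (fun t => deriv (fun s => ρc n c s φ) t) θ)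
        (𝓝[>] (-(π / 2))) (𝓝 1) := by
  constructor
  · exact (rho_lim n hc φ (σ := 1) (x0 := π / 2) (Or.inl rfl) (by norm_num) (by ring)).mono_left
      (nhdsWithin_mono _ fun x hx => ne_of_lt hx)
  · have h := rho_lim n hc φ (σ := -1) (x0 := -(π / 2)) (Or.inr rfl) (by norm_num) (by ring)
    rw [neg_neg] at h
    exact h.mono_left (nhdsWithin_mono _ fun x hx => ne_of_gt hx)
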